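/- (Crawford–Williams optimality of the geometric mean for complete matrices.) Let C = [c_ij] be an n×n matrix of positive reals that is reciprocal (c_ji = 1/c_ij for all i, j, and c_ii = 1), and define g : Fin n → ℝ by g(i) = (∏_{j=1}^{n} c_ij)^{1/n}. Then for every positive vector v : Fin n → ℝ, Σ_{i,j=1}^{n} (log c_ij − log(g(i)/g(j)))² ≤ Σ_{i,j=1}^{n} (log c_ij − log(v(i)/v(j)))²; that is, the vector of row geometric means minimizes the logarithmic least-squares error S(C, v) = Σ_{i,j} (log c_ij − log(v(i)/v(j)))² over all positive vectors v. -/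

import Mathlib

/-- A matrix with vanishing row and column sums is orthogonal to all additively consistent
matrices `d i - d j`, so subtracting one of these cannot decrease the sum of squares. -/
lemma sum_sq_le_sum_sub_sq_of_sum_eq_zero {ι : Type*} [Fintype ι] (r : ι → ι → ℝ)
    (hrow : ∀ i, ∑ j, r i j = 0) (hcol : ∀ j, ∑ i, r i j = 0) (d : ι → ℝ) :
    ∑ i, ∑ j, r i j ^ 2 ≤ ∑ i, ∑ j, (r i j - (d i - d j)) ^ 2 := by
  have h₁ : ∑ i, ∑ j, d i * r i j = 0 := by
    simp [← Finset.mul_sum, hrow]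
  have h₂ : ∑ i, ∑ j, d j * r i j = 0 := by
    rw [Finset.sum_comm]
    simp [← Finset.mul_sum, hcol]
  have h₃ : ∑ i, ∑ j, (r i j - (d i - d j)) ^ 2 = ∑ i, ∑ j, r i j ^ 2
      + ∑ i, ∑ j, (d i - d j) ^ 2 - 2 * ∑ i, ∑ j, d i * r i j
      + 2 * ∑ i, ∑ j, d j * r i j := by
    simp only [Finset.mul_sum, ← Finset.sum_add_distrib, ← Finset.sum_sub_distrib]
    refine Finset.sum_congr rfl fun i _ => Finset.sum_congr rfl fun j _ => ?_
    ring
  have h₄ : 0 ≤ ∑ i, ∑ j, (d i - d j) ^ 2 :=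
    Finset.sum_nonneg fun i _ => Finset.sum_nonneg fun j _ => sq_nonneg _
  linarith

/-- The row means of an antisymmetric matrix give its least-squares approximation by
additively consistent matrices `w i - w j`. -/
lemma sum_sub_row_mean_sq_le {ι : Type*} [Fintype ι] (a : ι → ι → ℝ)
    (ha : ∀ i j, a j i = -a i j) (u : ι → ℝ) (hu : ∀ i, Fintype.card ι * u i = ∑ j, a i j)
    (w : ι → ℝ) :
    ∑ i, ∑ j, (a i j - (u i - u j)) ^ 2 ≤ ∑ i, ∑ j, (a i j - (w i - w j)) ^ 2 := by
  rcases isEmpty_or_nonempty ι with hι | hι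
  · simp
  have hsum : ∑ i, ∑ j, a i j = 0 := by
    have h : ∑ i, ∑ j, a i j = -∑ i, ∑ j, a i j := by
      conv_lhs => rw [Finset.sum_comm]
      simp only [← Finset.sum_neg_distrib]
      exact Finset.sum_congr rfl fun i _ => Finset.sum_congr rfl fun j _ => ha i j
    linarith
  have husum : ∑ i, u i = 0 := by
    have hcard : (Fintype.card ι : ℝ) ≠ 0 := Nat.cast_ne_zero.mpr Fintype.card_ne_zero
    refine (mul_eq_zero.mp ?_).resolve_left hcard
    simpa only [Finset.mul_sum, hu] using hsum
  have hrow (i : ι) : ∑ j, (a i j - (u i - u j)) = 0 := by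
    simp [Finset.sum_sub_distrib, husum, hu]
  have hcol (j : ι) : ∑ i, (a i j - (u i - u j)) = 0 := by
    rw [← neg_eq_zero, ← Finset.sum_neg_distrib, ← hrow j]
    refine Finset.sum_congr rfl fun i _ => ?_
    rw [ha i j]
    ring
  refine (sum_sq_le_sum_sub_sq_of_sum_eq_zero _ hrow hcol (fun i => w i - u i)).trans_eq ?_
  refine Finset.sum_congr rfl fun i _ => Finset.sum_congr rfl fun j _ => ?_
  ring

/-- Crawford–Williams optimality of the geometric mean for complete reciprocal
PC matrices: the vector of row geometric means `g i = (∏ j, C i j)^(1/n)`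
minimizes the logarithmic least-squares error
`S(C, v) = ∑ i j, (log (C i j) − log (v i / v j))²` over all positive vectors `v`. -/
theorem geometric_mean_minimizes_lls (n : ℕ) (C : Fin n → Fin n → ℝ)
    (hpos : ∀ i j, 0 < C i j) (hdiag : ∀ i, C i i = 1)
    (hrecip : ∀ i j, C j i = 1 / C i j)
    (g : Fin n → ℝ) (hg : ∀ i, g i = (∏ j, C i j) ^ ((1 : ℝ) / n))
    (v : Fin n → ℝ) (hv : ∀ i, 0 < v i) :
    ∑ i, ∑ j, (Real.log (C i j) - Real.log (g i / g j)) ^ 2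
      ≤ ∑ i, ∑ j, (Real.log (C i j) - Real.log (v i / v j)) ^ 2 := by
  have hprod (i : Fin n) : 0 < ∏ j, C i j := Finset.prod_pos fun j _ => hpos i j
  have hgpos (i : Fin n) : 0 < g i := by
    rw [hg]
    exact Real.rpow_pos_of_pos (hprod i) _
  have hlog (x : Fin n → ℝ) (hx : ∀ i, 0 < x i) (i j : Fin n) :
      Real.log (x i / x j) = Real.log (x i) - Real.log (x j) :=
    Real.log_div (hx i).ne' (hx j).ne'
  simp only [hlog g hgpos, hlog v hv]
  refine sum_sub_row_mean_sq_le (fun i j => Real.log (C i j)) (fun i j => ?_)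
    (fun i => Real.log (g i)) (fun i => ?_) (fun i => Real.log (v i))
  · simp [hrecip i j]
  · have hn : (n : ℝ) ≠ 0 := Nat.cast_ne_zero.mpr i.pos.ne'
    rw [hg, Real.log_rpow (hprod i), Real.log_prod fun j _ => (hpos i j).ne', Fintype.card_fin]
    field_simp
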